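/- Let 1 < β ≤ 2. Then for every integer l ≥ 1, the tail of the fractional centered difference coefficients satisfies Σ_{|k|≥l} |ĝ_k^{(β)}| ≥ c_*^{(β)} / (l+1)^β, where the sum is over all integers k with |k| ≥ l. -/

import Mathlib

/-- Fractional centered difference coefficients `ĝ_k^{(β)}`. -/
noncomputable def ghat (β : ℝ) (k : ℤ) : ℝ :=
  (-1 : ℝ) ^ k * Real.Gamma (β + 1) /
    (Real.Gamma (β / 2 - k + 1) * Real.Gamma (β / 2 + k + 1))

/-- The `(M−1)×(M−1)` symmetric Toeplitz matrix `G_β`. -/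
noncomputable def Gmat (β : ℝ) (M : ℕ) : Matrix (Fin (M - 1)) (Fin (M - 1)) ℝ :=
  Matrix.of fun i j => ghat β ((i : ℤ) - (j : ℤ))

/-- First column of the circulant approximation `r(G_β)`. -/
noncomputable def rcol (β : ℝ) (M : ℕ) (k : ℕ) : ℝ :=
  if k = 0 then ghat β 0 else ghat β k + ghat β ((k : ℤ) - ((M : ℤ) - 1))

/-- The `(M−1)×(M−1)` circulant matrix `r(G_β)`. -/
noncomputable def circG (β : ℝ) (M : ℕ) : Matrix (Fin (M - 1)) (Fin (M - 1)) ℝ :=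
  Matrix.of fun i j => rcol β M ((((i : ℤ) - (j : ℤ)) % ((M : ℤ) - 1)).toNat)

/-- The constant `c_*^{(β)} = (2/β) r_β`. -/
noncomputable def cstar (β : ℝ) : ℝ :=
  (2 / β) * (Real.exp (-2) * ((4 - β) * (2 - β) * β) / ((6 + β) * (4 + β) * (2 + β)) *
    (Real.Gamma (β + 1) / (Real.Gamma (β / 2 + 1)) ^ 2) * (3 + β / 2) ^ (β + 1))

/-- Grünwald coefficients `g_k^{(γ)}`. -/
noncomputable def gcoef (γ : ℝ) : ℕ → ℝ
  | 0 => 1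
  | (k + 1) => (1 - (γ + 1) / (k + 1)) * gcoef γ k

/-- Weighted and shifted Grünwald coefficients `λ_k^{(γ)}`. -/
noncomputable def lamc (γ : ℝ) : ℕ → ℝ
  | 0 => 1 + γ / 2
  | (k + 1) => (1 + γ / 2) * gcoef γ (k + 1) - (γ / 2) * gcoef γ k

open Filter Topology in
theorem aux_tele (A : ℕ → ℝ) (hA : Antitone A) (h0 : Tendsto A atTop (𝓝 0)) :
    HasSum (fun n => A n - A (n + 1)) (A 0) := by
  rw [hasSum_iff_tendsto_nat_of_nonneg (fun n => sub_nonneg.2 (hA (Nat.le_succ n)))]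
  have h : ∀ n, ∑ i ∈ Finset.range n, (A i - A (i + 1)) = A 0 - A n := fun n =>
    Finset.sum_range_sub' A n
  simp_rw [h]
  simpa using (tendsto_const_nhds (x := A 0)).sub h0

theorem aux_sum (f : ℤ → ℝ) (hf : ∀ k, f (-k) = f k) (l : ℕ) (hl : 1 ≤ l) (S : ℝ)
    (h : HasSum (fun n : ℕ => f ((l + n : ℕ) : ℤ)) S) :
    HasSum (fun k : {k : ℤ // (l : ℤ) ≤ |k|} => f k) (S + S) := by
  let e0 : ℕ ⊕ ℕ → {k : ℤ // (l : ℤ) ≤ |k|} := Sum.elim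
    (fun n => ⟨((l + n : ℕ) : ℤ), by rw [Nat.abs_cast]; push_cast; omega⟩)
    (fun n => ⟨-((l + n : ℕ) : ℤ), by rw [abs_neg, Nat.abs_cast]; push_cast; omega⟩)
  have he : Function.Bijective e0 := by
    constructor
    · rintro (m | m) (n | n) hmn
      all_goals
        have := congrArg Subtype.val hmn
        simp [e0] at this
      · rw [this]
      · omega
      · omega
      · rw [this]
    · rintro ⟨k, hk⟩
      rcases le_total 0 k with h | h
      · rw [abs_of_nonneg h] at hk
        refine ⟨Sum.inl (k - l).toNat, Subtype.ext ?_⟩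
        simp [e0]; omega
      · rw [abs_of_nonpos h] at hk
        refine ⟨Sum.inr (-k - l).toNat, Subtype.ext ?_⟩
        simp [e0]; omega
  rw [← (Equiv.ofBijective e0 he).hasSum_iff]
  apply HasSum.sum
  · simpa [Function.comp_def, e0] using h
  · simp only [Function.comp_def, e0, Equiv.ofBijective_apply, Sum.elim_inr, hf]
    exact h

theorem ghat_neg' (β : ℝ) (k : ℤ) : ghat β (-k) = ghat β k := by
  unfold ghat
  rw [zpow_neg, ← inv_zpow, mul_comm (Real.Gamma (β / 2 - k + 1))]
  norm_num [sub_eq_add_neg]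

theorem ghat_succ' (β : ℝ) (h1 : 1 < β) (h2 : β < 2) (k : ℕ) :
    ghat β ((k + 1 : ℕ) : ℤ) * (k + 1 + β / 2) = (k - β / 2) * ghat β (k : ℤ) := by
  have hne : β / 2 - k ≠ 0 := by
    rcases Nat.eq_zero_or_pos k with rfl | hk
    · simp; linarith
    · have : (1 : ℝ) ≤ k := by exact_mod_cast hk
      intro h; linarith
  have hp : β / 2 + k + 1 ≠ 0 := by positivity
  unfold ghat
  have e1 := Real.Gamma_add_one hne
  have e2 := Real.Gamma_add_one hp
  push_cast
  rw [zpow_add_one₀ (by norm_num), e1, show β / 2 - (k + 1 : ℝ) + 1 = β / 2 - k by ring,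
    show β / 2 + (k + 1 : ℝ) + 1 = β / 2 + k + 1 + 1 by ring, e2]
  by_cases hg : Real.Gamma (β / 2 - k) = 0
  · simp [hg]
  have hg2 : Real.Gamma (β / 2 + k + 1) ≠ 0 := (Real.Gamma_pos_of_pos (by positivity)).ne'
  rw [show (k : ℝ) - β / 2 = -(β / 2 - k) by ring, show (k : ℝ) + 1 + β / 2 = β / 2 + k + 1 by ring]
  generalize Real.Gamma (β / 2 - k) = x at *
  generalize Real.Gamma (β / 2 + k + 1) = y at *
  generalize β / 2 - (k : ℝ) = u at *
  generalize β / 2 + (k : ℝ) + 1 = v at *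
  field_simp

theorem absg_succ (β : ℝ) (h1 : 1 < β) (h2 : β < 2) (k : ℕ) (hk : 1 ≤ k) :
    |ghat β ((k + 1 : ℕ) : ℤ)| * (k + 1 + β / 2) = (k - β / 2) * |ghat β (k : ℤ)| := by
  have h := congrArg abs (ghat_succ' β h1 h2 k)
  have : (1 : ℝ) ≤ k := by exact_mod_cast hk
  rwa [abs_mul, abs_mul, abs_of_nonneg (by positivity : (0 : ℝ) ≤ k + 1 + β / 2),
    abs_of_nonneg (by linarith : (0 : ℝ) ≤ k - β / 2)] at h

/-- the tail term `B k = |g_k| (k + β/2)` -/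
noncomputable def Bt (β : ℝ) (k : ℕ) : ℝ := |ghat β (k : ℤ)| * (k + β / 2)

theorem Bt_nonneg (β : ℝ) (h1 : 1 < β) (k : ℕ) : 0 ≤ Bt β k := by
  unfold Bt; positivity

theorem Bt_succ (β : ℝ) (h1 : 1 < β) (h2 : β < 2) (k : ℕ) (hk : 1 ≤ k) :
    Bt β (k + 1) * (k + β / 2) = Bt β k * (k - β / 2) := by
  have := absg_succ β h1 h2 k hk
  unfold Bt
  push_cast at *
  rw [this]; ring

theorem Bt_diff (β : ℝ) (h1 : 1 < β) (h2 : β < 2) (k : ℕ) (hk : 1 ≤ k) :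
    Bt β k - Bt β (k + 1) = β * |ghat β (k : ℤ)| := by
  have := absg_succ β h1 h2 k hk
  unfold Bt
  push_cast at *
  rw [this]; ring

theorem Bt_upper (β : ℝ) (h1 : 1 < β) (h2 : β < 2) (k : ℕ) (hk : 1 ≤ k) :
    Bt β k * k ≤ Bt β 1 := by
  induction k, hk using Nat.le_induction with
  | base => simp
  | succ k hk ih =>
    refine le_trans ?_ ih
    have h := Bt_succ β h1 h2 k hk
    have hk1 : (1 : ℝ) ≤ k := by exact_mod_cast hk
    have hp : 0 < (k : ℝ) + β / 2 := by positivity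
    have hB := Bt_nonneg β h1 k
    refine le_of_mul_le_mul_right ?_ hp
    push_cast
    calc Bt β (k + 1) * (k + 1) * (k + β / 2) = Bt β k * ((k - β / 2) * (k + 1)) := by
          rw [mul_right_comm, h]; ring
      _ ≤ Bt β k * (k * (k + β / 2)) := by
          apply mul_le_mul_of_nonneg_left _ hB; nlinarith
      _ = _ := by ring

theorem Bt_lower (β : ℝ) (h1 : 1 < β) (h2 : β < 2) (k : ℕ) (hk : 3 ≤ k) :
    Bt β 3 * (3 - β / 2) ^ β ≤ Bt β k * (k - β / 2) ^ β := by
  induction k, hk using Nat.le_induction with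
  | base => simp
  | succ k hk ih =>
    refine ih.trans ?_
    have h := Bt_succ β h1 h2 k (by omega)
    have hk1 : (3 : ℝ) ≤ k := by exact_mod_cast hk
    have hp : 0 < (k : ℝ) + β / 2 := by positivity
    have hm : 0 < (k : ℝ) - β / 2 := by linarith
    have hB := Bt_nonneg β h1 (k + 1)
    have bern := one_add_mul_self_le_rpow_one_add (s := 1 / ((k : ℝ) - β / 2))
      (le_trans (by norm_num) (by positivity : (0 : ℝ) ≤ 1 / ((k : ℝ) - β / 2))) h1.le
    have e1 : 1 + 1 / ((k : ℝ) - β / 2) = (((k + 1 : ℕ) : ℝ) - β / 2) / (k - β / 2) := by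
      rw [eq_div_iff hm.ne', add_mul, div_mul_cancel₀ _ hm.ne']; push_cast; ring
    have e2 : 1 + β * (1 / ((k : ℝ) - β / 2)) = (k + β / 2) / (k - β / 2) := by
      rw [eq_div_iff hm.ne', add_mul, mul_assoc, div_mul_cancel₀ _ hm.ne']; ring
    rw [e1, e2, Real.div_rpow (by push_cast; linarith) hm.le, div_le_div_iff₀ hm (by positivity)]
      at bern
    refine le_of_mul_le_mul_right ?_ hm
    calc Bt β k * (k - β / 2) ^ β * (k - β / 2) = Bt β (k + 1) * ((k + β / 2) * (k - β / 2) ^ β) := by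
          rw [mul_right_comm, ← h]; ring
      _ ≤ Bt β (k + 1) * ((((k + 1 : ℕ) : ℝ) - β / 2) ^ β * (k - β / 2)) :=
          mul_le_mul_of_nonneg_left bern hB
      _ = _ := by ring

theorem rpow_four (β x y : ℝ) (h1 : 1 < β) (h2 : β < 2) (hx : 0 ≤ x) (hy : 0 ≤ y)
    (hxy : x ≤ 2 * y) : x ^ β ≤ 4 * y ^ β := by
  calc x ^ β ≤ (2 * y) ^ β := Real.rpow_le_rpow hx hxy (by linarith)
    _ = 2 ^ β * y ^ β := Real.mul_rpow (by norm_num) hy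
    _ ≤ 2 ^ (2 : ℝ) * y ^ β := by
        apply mul_le_mul_of_nonneg_right _ (by positivity)
        exact Real.rpow_le_rpow_of_exponent_le (by norm_num) h2.le
    _ = _ := by norm_num

theorem Bt_main (β : ℝ) (h1 : 1 < β) (h2 : β < 2) (l : ℕ) (hl : 1 ≤ l) :
    Bt β 3 * (3 + β / 2) ^ β ≤ 4 * (Bt β l * ((l : ℝ) + 1) ^ β) := by
  have hl1 : (1 : ℝ) ≤ l := by exact_mod_cast hl
  have B3 := Bt_nonneg β h1 3
  have hBl := Bt_nonneg β h1 l
  rcases le_or_gt 3 l with h | h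
  · have hk1 : (3 : ℝ) ≤ l := by exact_mod_cast h
    calc Bt β 3 * (3 + β / 2) ^ β ≤ Bt β 3 * (4 * (3 - β / 2) ^ β) :=
          mul_le_mul_of_nonneg_left
            (rpow_four β _ _ h1 h2 (by linarith) (by linarith) (by linarith)) B3
      _ = 4 * (Bt β 3 * (3 - β / 2) ^ β) := by ring
      _ ≤ 4 * (Bt β l * (l - β / 2) ^ β) := by
          have := Bt_lower β h1 h2 l h
          linarith
      _ ≤ _ := by
          have : ((l : ℝ) - β / 2) ^ β ≤ ((l : ℝ) + 1) ^ β :=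
            Real.rpow_le_rpow (by linarith) (by linarith) (by linarith)
          have := mul_le_mul_of_nonneg_left this hBl
          linarith
  · have anti : ∀ k, 1 ≤ k → Bt β (k + 1) ≤ Bt β k := fun k hk => by
      have := Bt_diff β h1 h2 k hk
      have : 0 ≤ β * |ghat β (k : ℤ)| := by positivity
      linarith
    have a1 := anti 1 le_rfl
    have a2 := anti 2 (by norm_num)
    have hB : Bt β 3 ≤ Bt β l := by
      interval_cases l
      · exact a2.trans a1
      · exact a2
    calc Bt β 3 * (3 + β / 2) ^ β ≤ Bt β l * (4 * ((l : ℝ) + 1) ^ β) :=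
          mul_le_mul hB (rpow_four β _ _ h1 h2 (by linarith) (by linarith) (by linarith))
            (by positivity) hBl
      _ = _ := by ring

theorem cstar_eq (β : ℝ) (h1 : 1 < β) (h2 : β < 2) :
    cstar β = (2 / β) * (Real.exp (-2) * (Bt β 3 * (3 + β / 2) ^ β)) := by
  have g0 : ghat β 0 = Real.Gamma (β + 1) / (Real.Gamma (β / 2 + 1)) ^ 2 := by
    simp [ghat, sq]
  have hg0 : 0 ≤ ghat β 0 := by
    rw [g0]
    have := Real.Gamma_pos_of_pos (by linarith : 0 < β + 1)
    positivity
  have s0 := congrArg abs (ghat_succ' β h1 h2 0)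
  have s1 := absg_succ β h1 h2 1 le_rfl
  have s2 := absg_succ β h1 h2 2 (by norm_num)
  rw [abs_mul, abs_mul] at s0
  norm_num at s0 s1 s2
  rw [abs_of_nonneg (by positivity : 0 ≤ 1 + β / 2), abs_of_nonneg hg0,
    abs_of_nonneg (by positivity : 0 ≤ β / 2)] at s0
  have t1 : |ghat β 1| = β / 2 * ghat β 0 / (1 + β / 2) := by
    rw [eq_div_iff (by positivity)]; linarith
  have t2 : |ghat β 2| = (1 - β / 2) * |ghat β 1| / (2 + β / 2) := by
    rw [eq_div_iff (by positivity)]; linarith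
  have t3 : |ghat β 3| = (2 - β / 2) * |ghat β 2| / (3 + β / 2) := by
    rw [eq_div_iff (by positivity)]; linarith
  unfold cstar Bt
  rw [← g0, Real.rpow_add_one (by positivity)]
  push_cast
  rw [t3, t2, t1]
  field_simp
  ring

theorem exp_two_bound : Real.exp (-2) * 4 ≤ 1 := by
  rw [Real.exp_neg, inv_mul_le_iff₀ (Real.exp_pos _)]
  have h := Real.add_one_le_exp (1 : ℝ)
  have : Real.exp 2 = Real.exp 1 * Real.exp 1 := by rw [← Real.exp_add]; norm_num
  rw [this]; nlinarith

open Filter Topology in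
theorem tail_hasSum (β : ℝ) (h1 : 1 < β) (h2 : β < 2) (l : ℕ) (hl : 1 ≤ l) :
    HasSum (fun n : ℕ => |ghat β ((l + n : ℕ) : ℤ)|) (Bt β l / β) := by
  have hd : ∀ n : ℕ, Bt β (l + n) / β - Bt β (l + (n + 1)) / β = |ghat β ((l + n : ℕ) : ℤ)| := by
    intro n
    have := Bt_diff β h1 h2 (l + n) (by omega)
    rw [← sub_div, ← add_assoc, this]
    field_simp
  have := aux_tele (fun n => Bt β (l + n) / β) (antitone_nat_of_succ_le fun n => by
      have := hd n
      have := abs_nonneg (ghat β ((l + n : ℕ) : ℤ))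
      linarith) (by
      have hb : Tendsto (Bt β) atTop (𝓝 0) := by
        refine tendsto_of_tendsto_of_tendsto_of_le_of_le' tendsto_const_nhds
          (tendsto_const_div_atTop_nhds_zero_nat (Bt β 1))
          (Eventually.of_forall (Bt_nonneg β h1)) ?_
        filter_upwards [eventually_ge_atTop 1] with k hk
        have : (0 : ℝ) < k := by exact_mod_cast hk
        rw [le_div_iff₀ this]
        exact Bt_upper β h1 h2 k hk
      have := (hb.comp (tendsto_add_atTop_nat l)).div_const β
      simpa [Function.comp_def, add_comm] using this)
  simp only [hd] at this
  simpa using this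

/-- tail estimate `Σ_{|k| ≥ l} |ĝ_k^{(β)}| ≥ c_*^{(β)}/(l+1)^β` for `l ≥ 1`. -/
theorem stmt13 (β : ℝ) (hβ1 : 1 < β) (hβ2 : β ≤ 2) (l : ℕ) (hl : 1 ≤ l) :
    cstar β / ((l : ℝ) + 1) ^ β ≤ ∑' k : {k : ℤ // (l : ℤ) ≤ |k|}, |ghat β (k : ℤ)| := by
  rcases hβ2.eq_or_lt with rfl | h2
  · have : cstar 2 = 0 := by simp [cstar]
    rw [this, zero_div]
    exact tsum_nonneg fun _ => abs_nonneg _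
  have hs := aux_sum (fun k => |ghat β k|) (fun k => by simp only [ghat_neg']) l hl _
    (tail_hasSum β hβ1 h2 l hl)
  rw [hs.tsum_eq, cstar_eq β hβ1 h2, div_le_iff₀ (by positivity)]
  have hm := Bt_main β hβ1 h2 l hl
  have hB := Bt_nonneg β hβ1 l
  have key : Real.exp (-2) * (Bt β 3 * (3 + β / 2) ^ β) ≤ Bt β l * ((l : ℝ) + 1) ^ β := by
    calc _ ≤ Real.exp (-2) * (4 * (Bt β l * ((l : ℝ) + 1) ^ β)) :=
          mul_le_mul_of_nonneg_left hm (Real.exp_pos _).le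
      _ = (Real.exp (-2) * 4) * (Bt β l * ((l : ℝ) + 1) ^ β) := by ring
      _ ≤ 1 * (Bt β l * ((l : ℝ) + 1) ^ β) :=
          mul_le_mul_of_nonneg_right exp_two_bound (by positivity)
      _ = _ := one_mul _
  calc _ ≤ 2 / β * (Bt β l * ((l : ℝ) + 1) ^ β) :=
        mul_le_mul_of_nonneg_left key (by positivity)
    _ = _ := by ring
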